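/- arXiv:1107.2503 — 2 statements merged into one kernel-verified Lean document; each statement's English description precedes it below -/
import Mathlib

section
/- Let k ≥ 0 and let f : ℝ × ℝ × ℝ → ℝ satisfy |f(x₂, η₂, ε₂) − f(x₁, η₁, ε₁)| ≤ k(|x₂ − x₁| + |η₂ − η₁| + |ε₂ − ε₁|) for all arguments. Let ε ≥ 0, a ∈ ℝ, and for i = 1, 2 let bᵢ, ηᵢ ∈ ℝ and let xᵢ : [0, 2π] → ℝ be continuous functions satisfying the integral equation xᵢ(θ) = a cos(θ) + ε bᵢ sin(θ) − ε ∫₀^θ sin(θ − s) f(xᵢ(s), ηᵢ, ε) ds for all θ ∈ [0, 2π]. If 2πεk < 1, then sup_{θ ∈ [0, 2π]} |x₂(θ) − x₁(θ)| ≤ ε (|b₂ − b₁| + 2πk |η₂ − η₁|) / (1 − 2πεk). -/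
open Real

/-- The integrand of the variation-of-constants formula is integrable along a continuous function. -/
lemma intervalIntegrable_sin_sub_mul_comp {g x : ℝ → ℝ} {θ T : ℝ} (hg : Continuous g)
    (hx : ContinuousOn x (Set.Icc 0 T)) (hθ : θ ∈ Set.Icc 0 T) :
    IntervalIntegrable (fun s => Real.sin (θ - s) * g (x s)) MeasureTheory.volume 0 θ := by
  apply ContinuousOn.intervalIntegrable
  rw [Set.uIcc_of_le hθ.1]
  have hsin : Continuous fun s => Real.sin (θ - s) := by fun_prop
  exact hsin.continuousOn.mul
    (hg.comp_continuousOn (hx.mono (Set.Icc_subset_Icc_right hθ.2)))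

/-- A uniform bound on `g₂ ∘ x₂ - g₁ ∘ x₁` bounds the difference of the integral terms in the
variation-of-constants formula. -/
lemma abs_integral_sin_sub_mul_sub_le {g₁ g₂ x₁ x₂ : ℝ → ℝ} {θ T C : ℝ}
    (hg₁ : Continuous g₁) (hg₂ : Continuous g₂) (hx₁ : ContinuousOn x₁ (Set.Icc 0 T))
    (hx₂ : ContinuousOn x₂ (Set.Icc 0 T)) (hθ : θ ∈ Set.Icc 0 T)
    (hC : ∀ s ∈ Set.Icc 0 T, |g₂ (x₂ s) - g₁ (x₁ s)| ≤ C) :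
    |(∫ s in (0:ℝ)..θ, Real.sin (θ - s) * g₂ (x₂ s))
      - ∫ s in (0:ℝ)..θ, Real.sin (θ - s) * g₁ (x₁ s)| ≤ C * T := by
  have hC0 : 0 ≤ C := (abs_nonneg _).trans (hC θ hθ)
  rw [← intervalIntegral.integral_sub (intervalIntegrable_sin_sub_mul_comp hg₂ hx₂ hθ)
    (intervalIntegrable_sin_sub_mul_comp hg₁ hx₁ hθ), ← Real.norm_eq_abs]
  calc _ ≤ C * |θ - 0| := by
        refine intervalIntegral.norm_integral_le_of_norm_le_const fun s hs => ?_
        rw [Set.uIoc_of_le hθ.1] at hs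
        rw [← mul_sub, Real.norm_eq_abs, abs_mul]
        exact (mul_le_of_le_one_left (abs_nonneg _) (Real.abs_sin_le_one _)).trans
          (hC s ⟨hs.1.le, hs.2.trans hθ.2⟩)
    _ ≤ C * T := by
        rw [sub_zero, abs_of_nonneg hθ.1]
        exact mul_le_mul_of_nonneg_left hθ.2 hC0

/-- Lipschitz dependence of the solution of the integral equation
`x(θ) = a cos θ + εb sin θ − ε ∫₀^θ sin(θ−s) f(x(s),η,ε) ds`
on the parameters `(η, b)`, with modulus of order `ε`. -/
theorem stmt_11 (k : ℝ) (hk : 0 ≤ k)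
    (f : ℝ → ℝ → ℝ → ℝ)
    (hf : ∀ x₁ x₂ η₁ η₂ ε₁ ε₂ : ℝ,
      |f x₂ η₂ ε₂ - f x₁ η₁ ε₁| ≤ k * (|x₂ - x₁| + |η₂ - η₁| + |ε₂ - ε₁|))
    (ε : ℝ) (hε : 0 ≤ ε) (a b₁ b₂ η₁ η₂ : ℝ)
    (x₁ x₂ : ℝ → ℝ)
    (hx₁c : ContinuousOn x₁ (Set.Icc 0 (2 * π)))
    (hx₂c : ContinuousOn x₂ (Set.Icc 0 (2 * π)))
    (hx₁ : ∀ θ ∈ Set.Icc (0:ℝ) (2 * π),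
      x₁ θ = a * Real.cos θ + ε * b₁ * Real.sin θ
        - ε * ∫ s in (0:ℝ)..θ, Real.sin (θ - s) * f (x₁ s) η₁ ε)
    (hx₂ : ∀ θ ∈ Set.Icc (0:ℝ) (2 * π),
      x₂ θ = a * Real.cos θ + ε * b₂ * Real.sin θ
        - ε * ∫ s in (0:ℝ)..θ, Real.sin (θ - s) * f (x₂ s) η₂ ε)
    (hsmall : 2 * π * ε * k < 1) :
    ∀ θ ∈ Set.Icc (0:ℝ) (2 * π),
      |x₂ θ - x₁ θ| ≤ ε * (|b₂ - b₁| + 2 * π * k * |η₂ - η₁|) / (1 - 2 * π * ε * k) := by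
  have hfc (η : ℝ) : Continuous fun x => f x η ε :=
    (LipschitzWith.of_dist_le' (K := k) fun x y => by
      simpa [Real.dist_eq] using hf y x η η ε ε).continuous
  obtain ⟨θ₀, hθ₀, hmax⟩ := isCompact_Icc.exists_isMaxOn
    (Set.nonempty_Icc.mpr Real.two_pi_pos.le) (hx₂c.sub hx₁c).abs
  have hM (θ : ℝ) (hθ : θ ∈ Set.Icc (0:ℝ) (2 * π)) : |x₂ θ - x₁ θ| ≤ |x₂ θ₀ - x₁ θ₀| :=
    hmax hθ
  intro θ hθ
  refine (hM θ hθ).trans ?_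
  generalize hD : |x₂ θ₀ - x₁ θ₀| = M at hM ⊢
  have hint := abs_integral_sin_sub_mul_sub_le (C := k * (M + |η₂ - η₁|)) (hfc η₁) (hfc η₂)
    hx₁c hx₂c hθ₀ fun s hs => (hf (x₁ s) (x₂ s) η₁ η₂ ε ε).trans <| by
      rw [sub_self, abs_zero, add_zero]
      gcongr
      exact hM s hs
  have hsin : |(b₂ - b₁) * Real.sin θ₀| ≤ |b₂ - b₁| := by
    rw [abs_mul]
    exact mul_le_of_le_one_right (abs_nonneg _) (Real.abs_sin_le_one _)
  have hbound : M ≤ ε * (|b₂ - b₁| + k * (M + |η₂ - η₁|) * (2 * π)) := by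
    rw [hx₁ θ₀ hθ₀, hx₂ θ₀ hθ₀] at hD
    generalize (∫ s in (0:ℝ)..θ₀, Real.sin (θ₀ - s) * f (x₁ s) η₁ ε) = I₁ at hint hD
    generalize (∫ s in (0:ℝ)..θ₀, Real.sin (θ₀ - s) * f (x₂ s) η₂ ε) = I₂ at hint hD
    calc M = ε * |(b₂ - b₁) * Real.sin θ₀ - (I₂ - I₁)| := by
          rw [← hD, ← abs_of_nonneg hε, ← abs_mul, abs_of_nonneg hε]
          ring_nf
      _ ≤ _ := by
          gcongr
          exact (abs_sub _ _).trans (add_le_add hsin hint)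
  rw [le_div_iff₀ (by linarith)]
  linarith
end

section
/- Let a ≠ 0 and α ∈ ℝ, and define H : ℝ² → ℝ² by H(η, b) = (∫₀^{2π} sin(s) · (α − η)(a cos(s) + b sin(s)) ds, ∫₀^{2π} cos(s) · (α − η)(a cos(s) + b sin(s)) ds). Then H(η, b) = ((α − η) b π, (α − η) a π); H is differentiable, and for any η₀ ∈ ℝ its Fréchet derivative at the point (η₀, 0) is the linear map (η̇, ḃ) ↦ ((α − η₀) π ḃ, −a π η̇), which is a linear isomorphism of ℝ² if and only if α ≠ η₀. -/
open Real

/-- Orthogonality of sine and cosine over a period, tested against `sin`. -/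
lemma integral_sin_mul_trig_combination (c a b : ℝ) :
    ∫ s in (0:ℝ)..(2 * π), Real.sin s * (c * (a * Real.cos s + b * Real.sin s)) = c * b * π := by
  have h : ∀ s : ℝ, Real.sin s * (c * (a * Real.cos s + b * Real.sin s)) =
      c * a * (Real.sin s * Real.cos s) + c * b * Real.sin s ^ 2 := fun s => by ring
  simp_rw [h]
  rw [intervalIntegral.integral_add (Continuous.intervalIntegrable (by fun_prop) _ _)
    (Continuous.intervalIntegrable (by fun_prop) _ _),
    intervalIntegral.integral_const_mul, intervalIntegral.integral_const_mul,
    integral_sin_mul_cos₁, integral_sin_sq]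
  simp

/-- Orthogonality of sine and cosine over a period, tested against `cos`. -/
lemma integral_cos_mul_trig_combination (c a b : ℝ) :
    ∫ s in (0:ℝ)..(2 * π), Real.cos s * (c * (a * Real.cos s + b * Real.sin s)) = c * a * π := by
  have h : ∀ s : ℝ, Real.cos s * (c * (a * Real.cos s + b * Real.sin s)) =
      c * b * (Real.sin s * Real.cos s) + c * a * Real.cos s ^ 2 := fun s => by ring
  simp_rw [h]
  rw [intervalIntegral.integral_add (Continuous.intervalIntegrable (by fun_prop) _ _)
    (Continuous.intervalIntegrable (by fun_prop) _ _),
    intervalIntegral.integral_const_mul, intervalIntegral.integral_const_mul,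
    integral_sin_mul_cos₁, integral_cos_sq]
  simp

/-- An antidiagonal linear map of the plane is bijective iff both its entries are nonzero. -/
lemma bijective_antidiagonal_iff (c d : ℝ) :
    Function.Bijective (fun v : ℝ × ℝ => (c * v.2, d * v.1)) ↔ c ≠ 0 ∧ d ≠ 0 := by
  constructor
  · rintro ⟨-, hs⟩
    obtain ⟨v, hv⟩ := hs (1, 1)
    rw [Prod.mk.injEq] at hv
    exact ⟨left_ne_zero_of_mul_eq_one hv.1, left_ne_zero_of_mul_eq_one hv.2⟩
  · rintro ⟨hc, hd⟩
    refine ⟨fun v w h => ?_, fun w => ⟨(w.2 / d, w.1 / c), ?_⟩⟩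
    · rw [Prod.mk.injEq] at h
      exact Prod.ext (mul_left_cancel₀ hd h.2) (mul_left_cancel₀ hc h.1)
    · simp [mul_div_cancel₀, hc, hd]

/-- The periodicity map `H` of the linear estimator equation at `ε = 0`:
explicit value `H(η,b) = ((α−η)bπ, (α−η)aπ)`, differentiability, explicit Fréchet
derivative at `(η₀, 0)`, and invertibility of the derivative iff `α ≠ η₀`. -/
theorem stmt_13 (a : ℝ) (ha : a ≠ 0) (α : ℝ)
    (H : ℝ × ℝ → ℝ × ℝ)
    (hH : ∀ η b : ℝ, H (η, b) =
      ((∫ s in (0:ℝ)..(2 * π), Real.sin s * ((α - η) * (a * Real.cos s + b * Real.sin s))),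
       (∫ s in (0:ℝ)..(2 * π), Real.cos s * ((α - η) * (a * Real.cos s + b * Real.sin s))))) :
    (∀ η b : ℝ, H (η, b) = ((α - η) * b * π, (α - η) * a * π)) ∧
    Differentiable ℝ H ∧
    ∀ η₀ : ℝ,
      (∀ v : ℝ × ℝ, fderiv ℝ H (η₀, 0) v = ((α - η₀) * π * v.2, -a * π * v.1)) ∧
      (Function.Bijective (fderiv ℝ H (η₀, 0)) ↔ α ≠ η₀) := by
  have hval : ∀ η b : ℝ, H (η, b) = ((α - η) * b * π, (α - η) * a * π) := fun η b => by
    rw [hH, integral_sin_mul_trig_combination, integral_cos_mul_trig_combination]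
  have hfun : H = fun p : ℝ × ℝ => ((α - p.1) * p.2 * π, (α - p.1) * a * π) :=
    funext fun p => hval p.1 p.2
  refine ⟨hval, by rw [hfun]; fun_prop, fun η₀ => ?_⟩
  have hderiv : ∀ v : ℝ × ℝ,
      fderiv ℝ H (η₀, 0) v = ((α - η₀) * π * v.2, -a * π * v.1) := fun v => by
    have hsub : HasFDerivAt (fun p : ℝ × ℝ => α - p.1) (-ContinuousLinearMap.fst ℝ ℝ ℝ) (η₀, 0) :=
      hasFDerivAt_fst.const_sub α
    have hprod := ((hsub.fun_mul hasFDerivAt_snd).mul_const π).prodMk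
      ((hsub.mul_const a).mul_const π)
    rw [hfun, HasFDerivAt.fderiv hprod]
    ext <;> simp <;> ring
  refine ⟨hderiv, ?_⟩
  rw [show ⇑(fderiv ℝ H (η₀, 0)) = fun v : ℝ × ℝ => ((α - η₀) * π * v.2, -a * π * v.1) from
    funext hderiv, bijective_antidiagonal_iff]
  simp [ha, Real.pi_ne_zero, sub_eq_zero]
end
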